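/- arXiv:1606.00804 — 4 statements merged into one kernel-verified Lean document; each statement's English description precedes it below -/
import Mathlib

section
/- Let A = {1,…,k} with k ≥ 3, let λ = {λ_1,…,λ_l} be a partition of A, and let S be the generating set from Theorem LmConsGeneration: (1) τ_{a,b} for all 1 ≤ i ≤ l and all a ≠ b ∈ λ_i; (2) τ_{aa,ab} for each 1 ≤ i ≤ l with |λ_i| > 1 and one chosen pair a ≠ b ∈ λ_i; (3) 1-SWAP_{a,b} for each 1 ≤ i < j ≤ l and one chosen pair a ∈ λ_i, b ∈ λ_j. Then S generates τ_{wa,wb} for every string w over A and all a, b lying in a common block λ_i of λ. -/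
/-- A reversible gate function of arity `n` over alphabet `A`: a bijection `A^n → A^n`. -/
abbrev GateFun (A : Type*) (n : ℕ) := (Fin n → A) ≃ (Fin n → A)

/-- A reversible gate over alphabet `A`: an arity together with a bijection of that arity. -/
abbrev Gate (A : Type*) := Σ n : ℕ, GateFun A n

/-- The canonical identification `A^{n+m} ≃ A^n × A^m`. -/
def splitEquiv (A : Type*) (n m : ℕ) :
    (Fin (n + m) → A) ≃ ((Fin n → A) × (Fin m → A)) :=
  (Equiv.arrowCongr finSumFinEquiv.symm (Equiv.refl A)).trans
    (Equiv.sumArrowEquivProdArrow _ _ A)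

/-- The permutation gate `P_σ`, mapping `(a_1,…,a_n)` to `(a_{σ(1)},…,a_{σ(n)})`. -/
def permGate (A : Type*) {n : ℕ} (σ : Equiv.Perm (Fin n)) : GateFun A n :=
  Equiv.arrowCongr σ.symm (Equiv.refl A)

/-- Tensor product of gates. -/
def tensorGate {A : Type*} {n m : ℕ} (F : GateFun A n) (G : GateFun A m) :
    GateFun A (n + m) :=
  ((splitEquiv A n m).trans (F.prodCongr G)).trans (splitEquiv A n m).symm

/-- The generation relation: `Generates S g` means `g` can be generated from the set `S`
of reversible gates using the permutation, tensor product, composition and ancilla rules. -/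
inductive Generates {A : Type*} (S : Set (Gate A)) : Gate A → Prop
  | mem {g : Gate A} : g ∈ S → Generates S g
  | perm (n : ℕ) (σ : Equiv.Perm (Fin n)) : Generates S ⟨n, permGate A σ⟩
  | tensor {n m : ℕ} {F : GateFun A n} {G : GateFun A m} :
      Generates S ⟨n, F⟩ → Generates S ⟨m, G⟩ → Generates S ⟨n + m, tensorGate F G⟩
  | comp {n : ℕ} {F G : GateFun A n} :
      Generates S ⟨n, F⟩ → Generates S ⟨n, G⟩ → Generates S ⟨n, G.trans F⟩
  | ancilla {l m : ℕ} {F : GateFun A (l + m)} (a : Fin l → A) {F' : GateFun A m} :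
      Generates S ⟨l + m, F⟩ →
      (∀ b : Fin m → A,
        F ((splitEquiv A l m).symm (a, b)) = (splitEquiv A l m).symm (a, F' b)) →
      Generates S ⟨m, F'⟩

/-- The gate class `⟨S⟩` generated by a set `S` of reversible gates. -/
def genClosure {A : Type*} (S : Set (Gate A)) : Set (Gate A) := {g | Generates S g}

/-- A reversible gate class: a set of gates closed under the generation rules. -/
def IsGateClass {A : Type*} (S : Set (Gate A)) : Prop := ∀ g, Generates S g → g ∈ S

/-- The transposition gate `τ_{u,v}` exchanging the inputs `u` and `v`. -/
def tau {A : Type*} [DecidableEq A] {n : ℕ} (u v : Fin n → A) : GateFun A n :=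
  Equiv.swap u v

/-- The controlled gate `w-F`, mapping `w u` to `w F(u)` and fixing all other inputs. -/
def controlled {A : Type*} [DecidableEq A] {l n : ℕ} (w : Fin l → A) (F : GateFun A n) :
    GateFun A (l + n) :=
  ((splitEquiv A l n).trans
    (Equiv.prodCongrRight fun p => if p = w then F else Equiv.refl _)).trans
    (splitEquiv A l n).symm

/-- `SWAP_{a,b}` for single symbols `a`, `b`: exchanges `ab` and `ba`. -/
def swapGate {A : Type*} [DecidableEq A] (a b : A) : GateFun A 2 :=
  tau ![a, b] ![b, a]

/-- Number of occurrences of the symbol `a` in the string `x`. -/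
def countOf {A : Type*} [DecidableEq A] {n : ℕ} (a : A) (x : Fin n → A) : ℕ :=
  (Finset.univ.filter fun i => x i = a).card

/-- `f` is computed, for every numbering of the wires `ι`, by a gate generated from `S`. -/
def Realizes {A ι : Type*} (S : Set (Gate A)) (f : (ι → A) → (ι → A)) : Prop :=
  ∀ (n : ℕ) (e : ι ≃ Fin n), ∃ F : GateFun A n,
    Generates S ⟨n, F⟩ ∧ ∀ x : Fin n → A, f (x ∘ e) = F x ∘ e

open Classical in
/-- Exchange `p` and `q`, fixing everything else. -/
noncomputable def exch {X : Type*} (p q x : X) : X :=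
  if x = p then q else if x = q then p else x

/-- Apply `f` to the wires selected by `e`. -/
noncomputable def embGate {A ι κ : Type*} (e : ι → κ) (f : (ι → A) → (ι → A)) (x : κ → A) :
    κ → A :=
  Function.extend e (f (x ∘ e)) x

open Classical in
/-- Apply `G` to the wires selected by `t` when the wires selected by `e` carry a word in `D`. -/
noncomputable def ctl {A ι κ τ : Type*} (e : κ → ι) (D : Set (κ → A)) (t : τ → ι)
    (G : (τ → A) → (τ → A)) (x : ι → A) : ι → A :=
  if x ∘ e ∈ D then embGate t G x else x

/-- `G` on wires `τ`, controlled by the wires `κ` carrying a word in `D`. -/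
noncomputable abbrev ctlGate {A κ τ : Type*} (D : Set (κ → A)) (G : (τ → A) → (τ → A)) :
    (κ ⊕ τ → A) → (κ ⊕ τ → A) :=
  ctl Sum.inl D Sum.inr G

/-- Exchange the letters `a` and `b` on a single wire. -/
noncomputable abbrev letterSwap {A : Type*} (a b : A) : (Unit → A) → (Unit → A) :=
  exch (fun _ => a) (fun _ => b)

theorem permGate_apply {A : Type*} {n : ℕ} (σ : Equiv.Perm (Fin n)) (x : Fin n → A) :
    permGate A σ x = x ∘ σ := rfl

theorem splitEquiv_symm_apply {A : Type*} {n m : ℕ} (x : Fin n → A) (y : Fin m → A) :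
    (splitEquiv A n m).symm (x, y) = Sum.elim x y ∘ finSumFinEquiv.symm := rfl

theorem splitEquiv_apply {A : Type*} {n m : ℕ} (x : Fin (n + m) → A) :
    splitEquiv A n m x =
      (x ∘ finSumFinEquiv ∘ Sum.inl, x ∘ finSumFinEquiv ∘ Sum.inr) := rfl

theorem generates_refl {A : Type*} (S : Set (Gate A)) (n : ℕ) :
    Generates S ⟨n, Equiv.refl _⟩ := Generates.perm n (Equiv.refl _)

theorem generates_symm {A : Type*} [Finite A] {S : Set (Gate A)} {n : ℕ} {F : GateFun A n}
    (h : Generates S ⟨n, F⟩) : Generates S ⟨n, F.symm⟩ := by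
  have hpow : ∀ N : ℕ, Generates S ⟨n, (show Equiv.Perm (Fin n → A) from F) ^ N⟩ := by
    intro N
    induction N with
    | zero => exact generates_refl S n
    | succ N ih => rw [pow_succ]; exact Generates.comp ih h
  obtain ⟨N, hN⟩ : ∃ N : ℕ, (show Equiv.Perm (Fin n → A) from F)⁻¹ =
      (show Equiv.Perm (Fin n → A) from F) ^ N := by
    have hfin : IsOfFinOrder (show Equiv.Perm (Fin n → A) from F) := isOfFinOrder_of_finite _
    refine ⟨orderOf (show Equiv.Perm (Fin n → A) from F) - 1, ?_⟩
    rw [inv_eq_iff_mul_eq_one, ← pow_succ', Nat.sub_add_cancel hfin.orderOf_pos, pow_orderOf_eq_one]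
  have := hpow N
  rw [← hN] at this
  exact this

namespace Realizes

variable {A ι κ : Type*} {S : Set (Gate A)}

theorem refl : Realizes S (fun x : ι → A => x) := fun n _ =>
  ⟨Equiv.refl _, generates_refl S n, fun _ => rfl⟩

theorem comp {f g : (ι → A) → (ι → A)} (hf : Realizes S f) (hg : Realizes S g) :
    Realizes S (fun x => f (g x)) := by
  intro n e
  obtain ⟨F, hF, hfF⟩ := hf n e
  obtain ⟨G, hG, hgG⟩ := hg n e
  exact ⟨G.trans F, Generates.comp hF hG, fun x => by simp [hgG, hfF]⟩

theorem of_equiv {f : (ι → A) → (ι → A)} {n : ℕ} (e : ι ≃ Fin n) (F : GateFun A n)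
    (hF : Generates S ⟨n, F⟩) (h : ∀ x : Fin n → A, f (x ∘ e) = F x ∘ e) : Realizes S f := by
  intro n' e'
  obtain rfl : n = n' := Fin.equiv_iff_eq.1 ⟨e.symm.trans e'⟩
  refine ⟨((permGate A (e.symm.trans e')).trans F).trans (permGate A (e'.symm.trans e)),
    Generates.comp (Generates.perm _ _) (Generates.comp hF (Generates.perm _ _)), fun x => ?_⟩
  have := h (x ∘ e.symm.trans e')
  have h2 : (x ∘ (e.symm.trans e')) ∘ e = x ∘ e' := by ext; simp
  rw [h2] at this
  rw [this]
  ext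
  simp [permGate_apply]

theorem of_generates {n : ℕ} {F : GateFun A n} (hF : Generates S ⟨n, F⟩) :
    Realizes S (fun x => F x) :=
  of_equiv (Equiv.refl _) F hF fun _ => rfl

theorem bijective [Finite ι] {f : (ι → A) → (ι → A)} (hf : Realizes S f) :
    Function.Bijective f := by
  obtain ⟨n, ⟨e⟩⟩ := Finite.exists_equiv_fin ι
  obtain ⟨F, -, h⟩ := hf n e
  have : f = (Equiv.arrowCongr e.symm (Equiv.refl A)) ∘ F ∘
      (Equiv.arrowCongr e (Equiv.refl A)) := by
    funext x
    have := h (x ∘ e.symm)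
    have h2 : (x ∘ e.symm) ∘ e = x := by ext; simp
    rw [h2] at this
    rw [this]
    rfl
  rw [this]
  exact (Equiv.bijective _).comp (F.bijective.comp (Equiv.bijective _))

theorem exists_leftInverse [Finite A] [Finite ι] {f : (ι → A) → (ι → A)} (hf : Realizes S f) :
    ∃ g, Realizes S g ∧ Function.LeftInverse g f := by
  obtain ⟨n, ⟨e⟩⟩ := Finite.exists_equiv_fin ι
  obtain ⟨F, hF, h⟩ := hf n e
  refine ⟨fun x => F.symm (x ∘ e.symm) ∘ e, of_equiv e F.symm (generates_symm hF) fun x => ?_,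
    fun x => ?_⟩
  · have h2 : (x ∘ e) ∘ e.symm = x := by ext; simp
    rw [h2]
  · have h1 := h (x ∘ e.symm)
    have h2 : (x ∘ e.symm) ∘ e = x := by ext; simp
    rw [h2] at h1
    have h3 : ∀ y : Fin n → A, (y ∘ e) ∘ e.symm = y := fun y => by ext; simp
    simp only [h1, h3, Equiv.symm_apply_apply, h2]

theorem emb [Finite κ] {f : (ι → A) → (ι → A)} (hf : Realizes S f) {e : ι → κ}
    (he : Function.Injective e) : Realizes S (embGate e f) := by
  classical
  have : Finite ι := Finite.of_injective e he
  obtain ⟨n, ⟨u⟩⟩ := Finite.exists_equiv_fin ι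
  obtain ⟨m, ⟨v⟩⟩ := Finite.exists_equiv_fin ((Set.range e)ᶜ : Set κ)
  obtain ⟨F, hF, h⟩ := hf n u
  let E : κ ≃ Fin (n + m) := ((Equiv.Set.sumCompl (Set.range e)).symm.trans
    (((Equiv.ofInjective e he).symm.trans u).sumCongr v)).trans finSumFinEquiv
  have hE1 : ∀ i, E (e i) = finSumFinEquiv (Sum.inl (u i)) := fun i => by
    have : (Equiv.Set.sumCompl (Set.range e)).symm (e i) = Sum.inl ⟨e i, i, rfl⟩ :=
      Equiv.Set.sumCompl_symm_apply_of_mem (Set.mem_range_self i)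
    have h2 : (Equiv.ofInjective e he).symm ⟨e i, i, rfl⟩ = i :=
      Equiv.ofInjective_symm_apply he i
    simp [E, this, h2]
  have hE2 : ∀ j (hj : j ∈ (Set.range e)ᶜ), E j = finSumFinEquiv (Sum.inr (v ⟨j, hj⟩)) :=
    fun j hj => by
      have : (Equiv.Set.sumCompl (Set.range e)).symm j = Sum.inr ⟨j, hj⟩ :=
        Equiv.Set.sumCompl_symm_apply_of_notMem hj
      simp [E, this]
  refine of_equiv E (tensorGate F (Equiv.refl _)) (Generates.tensor hF (generates_refl S m))
    fun x => ?_
  have key : (x ∘ E) ∘ e = (x ∘ finSumFinEquiv ∘ Sum.inl) ∘ u := by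
    funext i; simp [hE1]
  funext j
  have ht : tensorGate F (Equiv.refl _) x =
    Sum.elim (F (x ∘ finSumFinEquiv ∘ Sum.inl)) (x ∘ finSumFinEquiv ∘ Sum.inr) ∘
      finSumFinEquiv.symm := rfl
  by_cases hj : j ∈ Set.range e
  · obtain ⟨i, rfl⟩ := hj
    rw [embGate, he.extend_apply, key, h, ht]
    simp [hE1]
  · rw [embGate, Function.extend_apply' _ _ _ hj, ht]
    simp [hE2 j hj]

theorem ancilla {ρ : Type*} [Finite A] [Finite ρ] {F : (ρ ⊕ ι → A) → (ρ ⊕ ι → A)}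
    {g : (ι → A) → (ι → A)} (hF : Realizes S F) (anc : ρ → A)
    (h : ∀ b, F (Sum.elim anc b) = Sum.elim anc (g b)) : Realizes S g := by
  intro n e
  have : Finite ι := Finite.of_equiv _ e.symm
  have hinj : Function.Injective g := by
    intro x y hxy
    have : F (Sum.elim anc x) = F (Sum.elim anc y) := by rw [h, h, hxy]
    have := hF.bijective.1 this
    simpa using congrArg (fun z => z ∘ Sum.inr) this
  obtain ⟨l, ⟨u⟩⟩ := Finite.exists_equiv_fin ρ
  obtain ⟨G, hG, hFG⟩ := hF (l + n) ((u.sumCongr e).trans finSumFinEquiv)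
  let g' : (Fin n → A) → (Fin n → A) := fun x => g (x ∘ e) ∘ e.symm
  have hg' : Function.Injective g' := by
    intro x y hxy
    have h1 := congrArg (fun z => z ∘ e) hxy
    have h2 : ∀ z : ι → A, (z ∘ e.symm) ∘ e = z := fun z => by ext; simp
    simp only [g', h2] at h1
    have h3 := congrArg (fun z => z ∘ e.symm) (hinj h1)
    have h4 : ∀ z : Fin n → A, (z ∘ e) ∘ e.symm = z := fun z => by ext; simp
    simpa only [h4] using h3
  refine ⟨Equiv.ofBijective g' (Finite.injective_iff_bijective.1 hg'),
    Generates.ancilla (anc ∘ u.symm) hG fun b => ?_, fun x => ?_⟩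
  · have h1 := hFG ((splitEquiv A l n).symm (anc ∘ u.symm, b))
    have h2 : (splitEquiv A l n).symm (anc ∘ u.symm, b) ∘
        ((u.sumCongr e).trans finSumFinEquiv) = Sum.elim anc (b ∘ e) := by
      funext j
      rcases j with j | j <;> simp [splitEquiv_symm_apply]
    rw [h2, h] at h1
    have h3 := congrArg (fun z => z ∘ ((u.sumCongr e).trans finSumFinEquiv).symm) h1
    have h4 : ∀ z : Fin (l + n) → A, (z ∘ ((u.sumCongr e).trans finSumFinEquiv)) ∘
        ((u.sumCongr e).trans finSumFinEquiv).symm = z := fun z => by ext; simp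
    simp only [h4] at h3
    rw [← h3]
    funext j
    obtain ⟨j, rfl⟩ := finSumFinEquiv.surjective j
    rcases j with j | j <;> simp [splitEquiv_symm_apply, g']
  · ext; simp [g']

/-- Compute with ancillas, act, uncompute. -/
theorem of_compute {ρ : Type*} [Finite A] [Finite ρ] [Finite ι]
    {V W : (ρ ⊕ ι → A) → (ρ ⊕ ι → A)} {g : (ι → A) → (ι → A)}
    (hV : Realizes S V) (hW : Realizes S W) (anc : ρ → A)
    (h : ∀ b, W (V (Sum.elim anc b)) = V (Sum.elim anc (g b))) : Realizes S g := by
  obtain ⟨U, hU, hUV⟩ := hV.exists_leftInverse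
  exact ancilla (hU.comp (hW.comp hV)) anc fun b => by rw [h, hUV]

end Realizes

section Apply

variable {A ι κ τ : Type*}

theorem embGate_comp_self {e : ι → κ} (he : Function.Injective e) (f : (ι → A) → (ι → A))
    (x : κ → A) : embGate e f x ∘ e = f (x ∘ e) := by
  funext i; simp [embGate, he.extend_apply]

theorem embGate_apply_of_notMem {e : ι → κ} (f : (ι → A) → (ι → A)) (x : κ → A) {j : κ}
    (hj : ∀ i, e i ≠ j) : embGate e f x j = x j :=
  Function.extend_apply' _ _ _ (by simpa using hj)

open Classical in
theorem ctl_apply_target {e : κ → ι} (D : Set (κ → A)) {t : τ → ι} (ht : Function.Injective t)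
    (G : (τ → A) → (τ → A)) (x : ι → A) (i : τ) :
    ctl e D t G x (t i) = if x ∘ e ∈ D then G (x ∘ t) i else x (t i) := by
  unfold ctl
  split_ifs
  · exact congrFun (embGate_comp_self ht G x) i
  · rfl

theorem ctl_apply_of_notMem {e : κ → ι} (D : Set (κ → A)) {t : τ → ι}
    (G : (τ → A) → (τ → A)) (x : ι → A) {j : ι} (hj : ∀ i, t i ≠ j) :
    ctl e D t G x j = x j := by
  unfold ctl
  split_ifs
  · exact embGate_apply_of_notMem G x hj
  · rfl

theorem exch_left {X : Type*} (p q : X) : exch p q p = q := by simp [exch]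

theorem exch_right {X : Type*} (p q : X) : exch p q q = p := by
  by_cases h : q = p
  · simp [exch, h]
  · simp [exch, h]

theorem exch_of_ne {X : Type*} {p q x : X} (hp : x ≠ p) (hq : x ≠ q) : exch p q x = x := by
  simp [exch, hp, hq]

theorem exch_map {X Y : Type*} {h : X → Y} (hh : Function.Injective h) (p q x : X) :
    exch (h p) (h q) (h x) = h (exch p q x) := by
  by_cases hp : x = p
  · rw [hp, exch_left, exch_left]
  · by_cases hq : x = q
    · rw [hq, exch_right, exch_right]
    · rw [exch_of_ne hp hq, exch_of_ne (fun e => hp (hh e)) (fun e => hq (hh e))]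

theorem exch_self {X : Type*} (p x : X) : exch p p x = x := by
  by_cases h : x = p
  · rw [h, exch_left]
  · exact exch_of_ne h h

theorem exch_comm {X : Type*} (p q x : X) : exch p q x = exch q p x := by
  by_cases hp : x = p
  · rw [hp, exch_left, exch_right]
  · by_cases hq : x = q
    · rw [hq, exch_left, exch_right]
    · rw [exch_of_ne hp hq, exch_of_ne hq hp]

theorem exch_exch {X : Type*} (p q x : X) : exch p q (exch p q x) = x := by
  by_cases hp : x = p
  · rw [hp, exch_left, exch_right]
  · by_cases hq : x = q
    · rw [hq, exch_right, exch_left]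
    · rw [exch_of_ne hp hq, exch_of_ne hp hq]

theorem exch_conj {X : Type*} {h : X → X} (hh : ∀ x, h (h x) = x) (p q x : X) :
    h (exch p q (h x)) = exch (h p) (h q) x := by
  by_cases hp : x = h p
  · rw [hp, hh, exch_left, exch_left]
  · by_cases hq : x = h q
    · rw [hq, hh, exch_right, exch_right]
    · rw [exch_of_ne hp hq, exch_of_ne, hh]
      · exact fun e => hp (by rw [← e, hh])
      · exact fun e => hq (by rw [← e, hh])

theorem letterSwap_apply (a b : A) (x : Unit → A) (u : Unit) :
    letterSwap a b x u = exch a b (x u) := by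
  obtain ⟨c, rfl⟩ : ∃ c, x = fun _ => c := ⟨x (), rfl⟩
  by_cases ha : c = a
  · rw [ha, letterSwap, exch_left, exch_left]
  · by_cases hb : c = b
    · rw [hb, letterSwap, exch_right, exch_right]
    · rw [letterSwap, exch_of_ne ha hb, exch_of_ne (fun h => ha (congrFun h ()))
        (fun h => hb (congrFun h ()))]

theorem ctlGate_inl (D : Set (κ → A)) (G : (τ → A) → (τ → A)) (x : κ ⊕ τ → A) (i : κ) :
    ctlGate D G x (Sum.inl i) = x (Sum.inl i) :=
  ctl_apply_of_notMem _ _ _ (by simp)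

open Classical in
theorem ctlGate_inr (D : Set (κ → A)) (G : (τ → A) → (τ → A)) (x : κ ⊕ τ → A) (i : τ) :
    ctlGate D G x (Sum.inr i) =
      if x ∘ Sum.inl ∈ D then G (x ∘ Sum.inr) i else x (Sum.inr i) :=
  ctl_apply_target _ Sum.inr_injective _ _ _

open Classical in
theorem ctl_letterSwap_apply {e : κ → ι} (D : Set (κ → A)) (j : ι) (a b : A) (x : ι → A) :
    ctl e D (fun _ : Unit => j) (letterSwap a b) x j =
      if x ∘ e ∈ D then exch a b (x j) else x j := by
  have := ctl_apply_target (e := e) D (t := fun _ : Unit => j) (fun _ _ _ => rfl)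
    (letterSwap a b) x ()
  rw [letterSwap_apply] at this
  exact this

theorem coe_tau [DecidableEq A] {n : ℕ} (u v : Fin n → A) : ⇑(tau u v) = exch u v := by
  funext x
  simp only [tau, Equiv.swap_apply_def, exch]
  split_ifs <;> rfl

theorem ctlGate_singleton_exch (w : κ → A) (y z : τ → A) :
    ctlGate {w} (exch y z) = exch (Sum.elim w y) (Sum.elim w z) := by
  classical
  funext x
  have key : ∀ r : τ → A, x = Sum.elim w r ↔ x ∘ Sum.inl = w ∧ x ∘ Sum.inr = r := by
    intro r
    constructor
    · rintro rfl; simp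
    · rintro ⟨rfl, rfl⟩; simp
  funext j
  rcases j with j | j
  · rw [ctlGate_inl]
    simp only [exch, key]
    split_ifs with h1 h2
    · simp [← h1.1]
    · simp [← h2.1]
    · rfl
  · rw [ctlGate_inr]
    simp only [exch, key, Set.mem_singleton_iff]
    split_ifs <;> simp_all

end Apply

namespace Realizes

variable {A ι κ τ : Type*} {S : Set (Gate A)}

theorem congr_fun {f g : (ι → A) → (ι → A)} (hf : Realizes S f) (h : ∀ x, g x = f x) :
    Realizes S g := by
  rwa [show g = f from funext h]

theorem embCtl [Finite ι] {D : Set (κ → A)} {G : (τ → A) → (τ → A)}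
    (h : Realizes S (ctlGate D G)) {e : κ → ι} {t : τ → ι}
    (hinj : Function.Injective (Sum.elim e t)) : Realizes S (ctl e D t G) := by
  classical
  refine (h.emb hinj).congr_fun fun x => ?_
  have ht : Function.Injective t := (Sum.elim_injective.1 hinj).2.1
  have hdis : ∀ a b, e a ≠ t b := (Sum.elim_injective.1 hinj).2.2
  have he : Function.Injective e := (Sum.elim_injective.1 hinj).1
  funext j
  by_cases hj : ∃ i, t i = j
  · obtain ⟨i, rfl⟩ := hj
    rw [ctl_apply_target _ ht]
    have := congrFun (embGate_comp_self hinj (ctlGate D G) x) (Sum.inr i)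
    rw [ctlGate_inr] at this
    exact this.symm
  · push Not at hj
    rw [ctl_apply_of_notMem _ _ _ hj]
    by_cases hj' : ∃ i, e i = j
    · obtain ⟨i, rfl⟩ := hj'
      have := congrFun (embGate_comp_self hinj (ctlGate D G) x) (Sum.inl i)
      rw [ctlGate_inl] at this
      exact this.symm
    · push Not at hj'
      rw [embGate_apply_of_notMem _ _ (by rintro (i | i); exacts [hj' i, hj i])]

/-- If `V` records membership in `D` on wire `j`, control by wire `j` gives control by `D`. -/
theorem cascade {ρ : Type*} [Finite A] [Finite ρ] [Finite κ] [Finite τ]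
    {V : (ρ ⊕ κ → A) → (ρ ⊕ κ → A)} (hV : Realizes S V) (anc : ρ → A) (j : ρ ⊕ κ) (d : A)
    {D : Set (κ → A)} (hD : ∀ w, V (Sum.elim anc w) j = d ↔ w ∈ D)
    {G : (τ → A) → (τ → A)} (hG : Realizes S (ctlGate {fun _ : Unit => d} G)) :
    Realizes S (ctlGate D G) := by
  classical
  let m : ρ ⊕ κ → ρ ⊕ (κ ⊕ τ) := Sum.map (fun i => i) Sum.inl
  have hm : Function.Injective m := Function.Injective.sumMap (fun _ _ h => h)
    Sum.inl_injective
  have ht : Function.Injective (Sum.inr ∘ Sum.inr : τ → ρ ⊕ (κ ⊕ τ)) :=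
    Sum.inr_injective.comp Sum.inr_injective
  have hmt : ∀ i i', m i ≠ (Sum.inr ∘ Sum.inr : τ → ρ ⊕ (κ ⊕ τ)) i' := by
    rintro (i | i) i' <;> simp [m]
  have hW : Realizes S (ctl (fun _ : Unit => m j) {fun _ : Unit => d}
      (Sum.inr ∘ Sum.inr : τ → ρ ⊕ (κ ⊕ τ)) G) :=
    hG.embCtl (Sum.elim_injective.2 ⟨fun _ _ _ => rfl, ht, fun _ i => hmt j i⟩)
  refine of_compute (hV.emb hm) hW anc fun b => ?_
  have hVm : ∀ (b : κ ⊕ τ → A), embGate m V (Sum.elim anc b) ∘ m =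
      V (Sum.elim anc (b ∘ Sum.inl)) := by
    intro b
    rw [embGate_comp_self hm]
    congr 1
    funext i
    rcases i with i | i <;> rfl
  have hVt : ∀ (b : κ ⊕ τ → A), embGate m V (Sum.elim anc b) ∘ (Sum.inr ∘ Sum.inr) =
      b ∘ Sum.inr := by
    intro b
    funext i
    exact embGate_apply_of_notMem _ _ (fun i' => hmt i' i)
  have hl : ctlGate D G b ∘ Sum.inl = b ∘ Sum.inl := by
    funext i; exact ctlGate_inl _ _ _ _
  have hcond : (embGate m V (Sum.elim anc b) ∘ fun _ : Unit => m j) ∈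
      ({fun _ : Unit => d} : Set (Unit → A)) ↔ b ∘ Sum.inl ∈ D := by
    rw [← hD, ← hVm b, Set.mem_singleton_iff]
    exact ⟨fun h => congrFun h (), fun h => funext fun _ => h⟩
  have hcover : ∀ i : ρ ⊕ (κ ⊕ τ), (∃ i', m i' = i) ∨ ∃ i' : τ, (Sum.inr ∘ Sum.inr) i' = i := by
    rintro (i | i | i)
    · exact Or.inl ⟨Sum.inl i, rfl⟩
    · exact Or.inl ⟨Sum.inr i, rfl⟩
    · exact Or.inr ⟨i, rfl⟩
  funext i
  rcases hcover i with ⟨i, rfl⟩ | ⟨i, rfl⟩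
  · rw [ctl_apply_of_notMem _ _ _ (fun i' => (hmt i i').symm)]
    have h1 := congrFun (hVm b) i
    have h2 := congrFun (hVm (ctlGate D G b)) i
    rw [hl] at h2
    exact h1.trans h2.symm
  · rw [ctl_apply_target _ ht, hVt]
    have h1 := congrFun (hVt b) i
    have h2 := congrFun (hVt (ctlGate D G b)) i
    refine Eq.trans ?_ h2.symm
    rw [Function.comp_apply (f := ctlGate D G b), ctlGate_inr]
    simp only [hcond]
    split_ifs
    · rfl
    · exact h1

theorem exch_reindex [Finite κ] {u v : ι → A} (h : Realizes S (exch u v)) (e : κ ≃ ι) :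
    Realizes S (exch (u ∘ e) (v ∘ e)) := by
  refine (h.emb e.symm.injective).congr_fun fun x => ?_
  obtain ⟨y, rfl⟩ : ∃ y : ι → A, x = y ∘ e := ⟨x ∘ e.symm, by ext; simp⟩
  have hy : (y ∘ e) ∘ e.symm = y := by ext; simp
  rw [exch_map (h := fun z : ι → A => z ∘ e) e.surjective.injective_comp_right]
  funext j
  have := congrFun (embGate_comp_self e.symm.injective (exch u v) (y ∘ e)) (e j)
  rw [hy] at this
  simpa using this.symm

theorem exch_letter [Finite ι] {u v : ι → A} (h : Realizes S (exch u v)) {a b : A}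
    (hab : Realizes S (letterSwap a b)) (j : ι) :
    Realizes S (exch (embGate (fun _ : Unit => j) (letterSwap a b) u)
      (embGate (fun _ : Unit => j) (letterSwap a b) v)) := by
  have hj : Function.Injective (fun _ : Unit => j) := fun _ _ _ => rfl
  refine ((hab.emb hj).comp (h.comp (hab.emb hj))).congr_fun fun x => (exch_conj ?_ u v x).symm
  intro x
  funext i
  by_cases hi : j = i
  · subst hi
    have := congrFun (embGate_comp_self hj (letterSwap a b)
      (embGate (fun _ : Unit => j) (letterSwap a b) x)) ()
    rw [embGate_comp_self hj (letterSwap a b) x, letterSwap, exch_exch] at this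
    exact this
  · rw [embGate_apply_of_notMem _ _ (by simpa using hi),
      embGate_apply_of_notMem _ _ (by simpa using hi)]

/-- Drop a constant prefix. -/
theorem exch_of_ctl {ρ : Type*} [Finite A] [Finite ρ] {w : ρ → A} {u v : ι → A}
    (h : Realizes S (ctlGate {w} (exch u v))) : Realizes S (exch u v) := by
  classical
  refine ancilla h w fun b => ?_
  funext i
  rcases i with i | i
  · exact ctlGate_inl _ _ _ _
  · rw [ctlGate_inr]; simp

end Realizes

/-- Exchange the two-letter words `fc` and `cf`. -/
noncomputable abbrev pairSwap {A : Type*} (f c : A) : (Fin 2 → A) → (Fin 2 → A) :=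
  exch ![f, c] ![c, f]

/-- All letter swaps inside `P`, controlled by `D`, are generated by `S`. -/
def Ctrl {A κ : Type*} (S : Set (Gate A)) (P : Set A) (D : Set (κ → A)) : Prop :=
  ∀ a ∈ P, ∀ b ∈ P, Realizes S (ctlGate D (letterSwap a b))

theorem ctl_comp_disjoint {A ι κ κ' τ : Type*} {e : κ → ι} (D : Set (κ → A)) {t : τ → ι}
    (G : (τ → A) → (τ → A)) (x : ι → A) (e' : κ' → ι) (h : ∀ i k, t i ≠ e' k) :
    ctl e D t G x ∘ e' = x ∘ e' := by
  funext k
  exact ctl_apply_of_notMem _ _ _ fun i => h i k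

theorem pairSwap_comm {A : Type*} (f c : A) : pairSwap f c = pairSwap c f :=
  funext fun x => exch_comm _ _ x

theorem pairSwap_of_ne {A : Type*} {f c e : A} (hf : e ≠ f) (hc : e ≠ c) (y : A) :
    pairSwap f c ![e, y] = ![e, y] :=
  exch_of_ne (fun h => hf (congrFun h 0)) (fun h => hc (congrFun h 0))

namespace Ctrl

variable {A κ κ' : Type*} [Finite κ] {S : Set (Gate A)} {P : Set A}

theorem embInl {ρ : Type*} [Finite ρ] {D : Set (κ → A)} (h : Ctrl S P D) {a b : A}
    (ha : a ∈ P) (hb : b ∈ P) (j : ρ) :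
    Realizes S (ctl Sum.inr D (fun _ : Unit => (Sum.inl j : ρ ⊕ κ)) (letterSwap a b)) :=
  (h a ha b hb).embCtl
    (Sum.elim_injective.2 ⟨Sum.inr_injective, fun _ _ _ => rfl, fun _ _ => by simp⟩)

theorem univ (h : ∀ a ∈ P, ∀ b ∈ P, Realizes S (letterSwap a b)) :
    Ctrl S P (Set.univ : Set (κ → A)) := fun a ha b hb =>
  ((h a ha b hb).emb (Sum.inr_injective : Function.Injective (Sum.inr : Unit → κ ⊕ Unit))).congr_fun
    fun x => by simp [ctlGate, ctl]

theorem compl (h : ∀ a ∈ P, ∀ b ∈ P, Realizes S (letterSwap a b)) {D : Set (κ → A)}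
    (hD : Ctrl S P D) : Ctrl S P Dᶜ := by
  classical
  intro a ha b hb
  refine ((hD a ha b hb).comp (univ h a ha b hb)).congr_fun fun x => ?_
  have hl : (ctlGate Set.univ (letterSwap a b) x) ∘ Sum.inl = x ∘ Sum.inl := by
    funext i; exact ctlGate_inl _ _ _ _
  have hr : (ctlGate Set.univ (letterSwap a b) x) ∘ Sum.inr = letterSwap a b (x ∘ Sum.inr) := by
    funext i; simp [ctlGate_inr]
  funext i
  rcases i with i | i
  · simp only [ctlGate_inl]
  · rw [ctlGate_inr, ctlGate_inr, hl, hr, ← Function.comp_apply (f := ctlGate _ _ x), hr]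
    by_cases hx : x ∘ Sum.inl ∈ D
    · simp [hx, exch_exch]
    · simp [hx]

theorem preimage {D : Set (κ' → A)} (h : Ctrl S P D) {p : κ' → κ}
    (hp : Function.Injective p) : Ctrl S P {w : κ → A | w ∘ p ∈ D} := fun a ha b hb =>
  ((h a ha b hb).embCtl (e := Sum.inl ∘ p) (t := (Sum.inr : Unit → κ ⊕ Unit))
    (Sum.elim_injective.2 ⟨Sum.inl_injective.comp hp, Sum.inr_injective, fun _ _ => by simp⟩)).congr_fun
    fun _ => rfl

theorem singleton_of_notMem [Finite A] (h : ∀ a ∈ P, ∀ b ∈ P, Realizes S (letterSwap a b)) {p c : A}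
    (hpc : p ≠ c) (hp : Ctrl S P {fun _ : Unit => p}) (hsw : Realizes S (pairSwap p c)) :
    Ctrl S P {fun _ : Unit => c} := by
  have key : Ctrl S P ({fun _ : Unit => c}ᶜ : Set (Unit → A)) := by
    intro a ha b hb
    have hinj : Function.Injective (![Sum.inl (), Sum.inr ()] : Fin 2 → Unit ⊕ Unit) := by
      intro i j
      fin_cases i <;> fin_cases j <;> simp
    refine Realizes.cascade (hsw.emb hinj) (fun _ => p) (Sum.inl ()) p (fun w => ?_)
      (hp a ha b hb)
    obtain ⟨x, rfl⟩ : ∃ x, w = fun _ => x := ⟨w (), rfl⟩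
    have h1 := congrFun (embGate_comp_self hinj (pairSwap p c)
      (Sum.elim (fun _ => p) (fun _ => x))) 0
    have h2 : Sum.elim (fun _ => p) (fun _ => x) ∘
        (![Sum.inl (), Sum.inr ()] : Fin 2 → Unit ⊕ Unit) = ![p, x] := by
      funext i; fin_cases i <;> rfl
    rw [h2] at h1
    refine Iff.trans (Eq.congr_left h1) ?_
    by_cases hx : x = c
    · subst hx
      simp [exch_left, hpc.symm]
    · have hne : (fun _ : Unit => x) ≠ fun _ => c := fun e => hx (congrFun e ())
      by_cases hxp : x = p
      · subst hxp
        rw [pairSwap, exch_of_ne] <;> simp_all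
      · rw [pairSwap, exch_of_ne] <;> simp_all
  simpa using compl h key

theorem inter_of_three [Finite A] {D₁ D₂ : Set (κ → A)} (h₁ : Ctrl S P D₁) (h₂ : Ctrl S P D₂)
    (hP : ∀ c ∈ P, Ctrl S P {fun _ : Unit => c}) {p q r : A} (hp : p ∈ P) (hq : q ∈ P)
    (hr : r ∈ P) (hpq : p ≠ q) (hpr : p ≠ r) (hqr : q ≠ r) : Ctrl S P (D₁ ∩ D₂) := by
  classical
  intro a ha b hb
  have hX := h₁.embInl (ρ := Unit) hp hq ()
  have hY := h₂.embInl (ρ := Unit) hq hr ()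
  refine Realizes.cascade (hX.comp (hY.comp (hX.comp hY))) (fun _ => p) (Sum.inl ()) r
    (fun w => ?_) (hP r hr a ha b hb)
  have hc : ∀ (D : Set (κ → A)) (s t : A) (x : Unit ⊕ κ → A),
      ctl Sum.inr D (fun _ : Unit => (Sum.inl () : Unit ⊕ κ)) (letterSwap s t) x ∘ Sum.inr =
        x ∘ Sum.inr := fun D s t x => ctl_comp_disjoint _ _ _ _ (by simp)
  simp only [ctl_letterSwap_apply, hc, Sum.elim_comp_inr, Sum.elim_inl]
  by_cases hw₁ : w ∈ D₁ <;> by_cases hw₂ : w ∈ D₂ <;>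
    simp [hw₁, hw₂, exch_left, exch_right, exch_of_ne, hpq, hpr, hpr.symm, hqr.symm]

/-- Controlled letter swaps inside `P` give controlled swaps of a letter of `P` with
another letter. -/
theorem pairSwap [Finite A] {D : Set (κ → A)} (hD : Ctrl S P D) {o e f c : A}
    (ho : ∀ p ∈ P, ∀ c, c ∉ P → Realizes S (ctlGate {fun _ : Unit => o} (pairSwap p c)))
    (he : e ∈ P) (hf : f ∈ P) (hef : e ≠ f) (hc : c ∉ P) :
    Realizes S (ctlGate D (_root_.pairSwap f c)) := by
  classical
  by_cases hoP : o ∈ P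
  · obtain ⟨e', he', heo⟩ : ∃ e' ∈ P, e' ≠ o := by
      by_cases h : e = o
      · exact ⟨f, hf, fun h' => hef (h.trans h'.symm)⟩
      · exact ⟨e, he, h⟩
    refine Realizes.cascade (hD.embInl (ρ := Unit) he' hoP ()) (fun _ => e') (Sum.inl ()) o
      (fun w => ?_) (ho f hf c hc)
    rw [ctl_letterSwap_apply]
    by_cases hw : w ∈ D <;> simp [hw, exch_left, heo]
  · have hX := hD.embInl (ρ := Fin 2) he hf 0
    have hsw : Realizes S (_root_.pairSwap f o) := (ho f hf o hoP).exch_of_ctl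
    have hY := hsw.emb (Sum.inl_injective : Function.Injective (Sum.inl : Fin 2 → Fin 2 ⊕ κ))
    refine Realizes.cascade (hY.comp hX) ![e, o] (Sum.inl 0) o (fun w => ?_) (ho f hf c hc)
    set x := ctl Sum.inr D (fun _ : Unit => (Sum.inl 0 : Fin 2 ⊕ κ)) (letterSwap e f)
      (Sum.elim ![e, o] w) with hx
    have hxl : x ∘ Sum.inl = ![if w ∈ D then f else e, o] := by
      funext i
      fin_cases i
      · change x (Sum.inl 0) = _
        rw [hx, ctl_letterSwap_apply]
        simp [exch_left]
      · change x (Sum.inl 1) = _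
        rw [hx, ctl_apply_of_notMem _ _ _ (by simp)]
        rfl
    have h1 := congrFun (embGate_comp_self
      (Sum.inl_injective : Function.Injective (Sum.inl : Fin 2 → Fin 2 ⊕ κ))
      (_root_.pairSwap f o) x) 0
    rw [hxl] at h1
    refine Iff.trans (Eq.congr_left h1) ?_
    have heo : e ≠ o := fun h => hoP (h ▸ he)
    by_cases hw : w ∈ D
    · simp [hw, exch_left]
    · simp only [hw, if_false]
      rw [pairSwap_of_ne hef heo]
      simp [heo]

theorem inter_of_pairSwap [Finite A] {D₁ D₂ : Set (κ → A)} (h₁ : Ctrl S P D₁) (h₂ : Ctrl S P D₂)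
    (hP : ∀ c ∈ P, Ctrl S P {fun _ : Unit => c}) {o e f c : A}
    (ho : ∀ p ∈ P, ∀ c, c ∉ P →
      Realizes S (ctlGate {fun _ : Unit => o} (_root_.pairSwap p c)))
    (he : e ∈ P) (hf : f ∈ P) (hef : e ≠ f) (hc : c ∉ P) : Ctrl S P (D₁ ∩ D₂) := by
  classical
  intro a ha b hb
  have hX := h₂.embInl (ρ := Fin 2) he hf 0
  have hY := (h₁.pairSwap ho he hf hef hc).embCtl (ι := Fin 2 ⊕ κ) (e := Sum.inr)
    (t := Sum.inl)
    (Sum.elim_injective.2 ⟨Sum.inr_injective, Sum.inl_injective, fun _ _ => by simp⟩)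
  refine Realizes.cascade (hY.comp hX) ![e, c] (Sum.inl 1) f (fun w => ?_) (hP f hf a ha b hb)
  rw [ctl_apply_target _ Sum.inl_injective, ctl_comp_disjoint _ _ _ _ (by simp),
    ctl_apply_of_notMem _ _ _ (by simp), Sum.elim_comp_inr]
  set x := ctl Sum.inr D₂ (fun _ : Unit => (Sum.inl 0 : Fin 2 ⊕ κ)) (letterSwap e f)
    (Sum.elim ![e, c] w) with hx
  have hxl : x ∘ Sum.inl = ![if w ∈ D₂ then f else e, c] := by
    funext i
    fin_cases i
    · change x (Sum.inl 0) = _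
      rw [hx, ctl_letterSwap_apply]
      simp [exch_left]
    · change x (Sum.inl 1) = _
      rw [hx, ctl_apply_of_notMem _ _ _ (by simp)]
      rfl
  rw [hxl]
  have hce : e ≠ c := fun h => hc (h ▸ he)
  have hcf : c ≠ f := fun h => hc (h ▸ hf)
  by_cases hw₁ : w ∈ D₁
  · by_cases hw₂ : w ∈ D₂
    · simp [hw₁, hw₂, exch_left]
    · simp only [hw₁, hw₂, if_false, if_true]
      rw [pairSwap_of_ne hef hce]
      simp [hcf, hw₂]
  · simp [hw₁, hcf]

theorem singleton (h : ∀ a ∈ P, ∀ b ∈ P, Realizes S (letterSwap a b))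
    (hP : ∀ c, Ctrl S P {fun _ : Unit => c})
    (hinter : ∀ D₁ D₂ : Set (κ → A), Ctrl S P D₁ → Ctrl S P D₂ → Ctrl S P (D₁ ∩ D₂))
    (w : κ → A) : Ctrl S P {w} := by
  classical
  have := Fintype.ofFinite κ
  have key : ∀ s : Finset κ, Ctrl S P {x : κ → A | ∀ j ∈ s, x j = w j} := by
    intro s
    induction s using Finset.induction_on with
    | empty => simpa using univ h
    | insert j s _ ih =>
      have h1 := hinter _ _ ((hP (w j)).preimage (κ := κ) (p := fun _ => j) (fun _ _ _ => rfl)) ih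
      convert h1 using 1
      ext x
      simp only [Finset.forall_mem_insert, Set.mem_ofPred_eq, Set.mem_inter_iff,
        Set.mem_singleton_iff]
      exact and_congr_left fun _ => ⟨fun hx => funext fun _ => hx, fun hx => congrFun hx ()⟩
  convert key Finset.univ using 1
  ext x
  simp [funext_iff]

end Ctrl

section Words

variable {A : Type*} {S : Set (Gate A)}

theorem embGate_letterSwap_apply {ι : Type*} [DecidableEq ι] (j : ι) (a b : A) (x : ι → A)
    (i : ι) : embGate (fun _ : Unit => j) (letterSwap a b) x i =
      if i = j then exch a b (x i) else x i := by
  split_ifs with h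
  · subst h
    have := congrFun (embGate_comp_self (fun _ _ _ => rfl : Function.Injective fun _ : Unit => i)
      (letterSwap a b) x) ()
    rw [letterSwap_apply] at this
    exact this
  · exact embGate_apply_of_notMem _ _ fun _ => Ne.symm h

theorem Realizes.pairSwap_left {w : Unit → A} {p p' c : A}
    (h : Realizes S (ctlGate {w} (pairSwap p c))) (hp : Realizes S (letterSwap p p'))
    (hc : c ≠ p) (hc' : c ≠ p') : Realizes S (ctlGate {w} (pairSwap p' c)) := by
  classical
  rw [pairSwap, ctlGate_singleton_exch] at h ⊢
  convert (h.exch_letter hp (Sum.inr 0)).exch_letter hp (Sum.inr 1) using 2 <;>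
  · funext i
    rcases i with i | i
    · simp [embGate_letterSwap_apply]
    · fin_cases i <;>
        simp [embGate_letterSwap_apply, exch_left, exch_of_ne hc hc']

theorem realizes_ctlGate_pairSwap [DecidableEq A] {o p c : A}
    (h : Generates S ⟨1 + 2, controlled ![o] (swapGate p c)⟩) :
    Realizes S (ctlGate {fun _ : Unit => o} (pairSwap p c)) := by
  refine Realizes.of_equiv (((Equiv.ofUnique Unit (Fin 1)).sumCongr (Equiv.refl _)).trans
    finSumFinEquiv) _ h fun x => ?_
  have hcond : (x ∘ ((Equiv.ofUnique Unit (Fin 1)).sumCongr (Equiv.refl (Fin 2))).trans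
      finSumFinEquiv) ∘ Sum.inl = (fun _ : Unit => o) ↔
      x ∘ finSumFinEquiv ∘ Sum.inl = ![o] := by
    constructor
    · intro h
      funext i
      have := congrFun h ()
      fin_cases i
      simpa using this
    · intro h
      funext i
      exact congrFun h 0
  funext i
  rcases i with i | i
  · rw [ctlGate_inl]
    simp only [controlled, Equiv.trans_apply, splitEquiv_apply, Function.comp_apply,
      splitEquiv_symm_apply, Equiv.symm_apply_apply, Equiv.sumCongr_apply, Sum.map_inl,
      Equiv.prodCongrRight_apply, Sum.elim_inl]
  · rw [ctlGate_inr]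
    simp only [Set.mem_singleton_iff, hcond]
    simp only [controlled, Equiv.trans_apply, splitEquiv_apply, Function.comp_apply,
      splitEquiv_symm_apply, Equiv.symm_apply_apply, Equiv.sumCongr_apply, Sum.map_inr,
      Equiv.prodCongrRight_apply, Sum.elim_inr]
    split_ifs
    · rw [swapGate, coe_tau]
      rfl
    · rfl

theorem Ctrl.singleton_of_mem {P : Set A}
    (hP : ∀ a ∈ P, ∀ b ∈ P, Realizes S (letterSwap a b)) {p q : A} (hp : p ∈ P) (hq : q ∈ P)
    (hpq : p ≠ q) (h : Realizes S (exch ![p, p] ![p, q])) :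
    ∀ c ∈ P, Ctrl S P {fun _ : Unit => c} := by
  classical
  intro c hc a ha b hb
  by_cases hab : a = b
  · subst hab
    exact Realizes.refl.congr_fun fun x => by
      rw [letterSwap, ctlGate_singleton_exch, exch_self]
  have hconj : ∀ {x y z s t : A}, s ∈ P → t ∈ P → Realizes S (exch ![x, y] ![x, z]) →
      Realizes S (exch ![x, exch s t y] ![x, exch s t z]) := by
    intro x y z s t hs ht h
    convert h.exch_letter (hP s hs t ht) 1 using 2 <;>
    · funext i
      fin_cases i <;> simp [embGate_letterSwap_apply]
  have hfirst : Realizes S (exch ![c, p] ![c, q]) := by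
    convert h.exch_letter (hP p hp c hc) 0 using 2 <;>
    · funext i
      fin_cases i <;> simp [embGate_letterSwap_apply, exch_left]
  have hsecond := hconj hp ha hfirst
  rw [exch_left] at hsecond
  have hne : a ≠ exch p a q := by
    intro h
    have := congrArg (exch p a) h
    rw [exch_exch, exch_right] at this
    exact hpq this
  have hmem : exch p a q ∈ P := by
    by_cases hqa : q = a
    · rw [hqa, exch_right]
      exact hp
    · rw [exch_of_ne hpq.symm hqa]
      exact hq
  have hthird := hconj hmem hb hsecond
  rw [exch_left, exch_of_ne hne hab] at hthird
  rw [letterSwap, ctlGate_singleton_exch]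
  convert hthird.exch_reindex (((Equiv.ofUnique Unit (Fin 1)).sumCongr
    (Equiv.ofUnique Unit (Fin 1))).trans finSumFinEquiv) using 2 <;>
  · funext i
    rcases i with i | i <;> rfl

theorem generates_tau_snoc [DecidableEq A] {m : ℕ} {w : Fin m → A} {a b : A}
    (h : Realizes S (ctlGate {w} (letterSwap a b))) :
    Generates S ⟨m + 1, tau (Fin.snoc w a) (Fin.snoc w b)⟩ := by
  rw [letterSwap, ctlGate_singleton_exch] at h
  let e : Fin (m + 1) ≃ Fin m ⊕ Unit :=
    finSumFinEquiv.symm.trans ((Equiv.refl _).sumCongr (Equiv.ofUnique (Fin 1) Unit))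
  have he : ∀ c : A, Sum.elim w (fun _ => c) ∘ e = Fin.snoc w c := by
    intro c
    funext i
    obtain ⟨i, rfl⟩ := finSumFinEquiv.surjective i
    rcases i with i | i
    · have : (finSumFinEquiv (Sum.inl i) : Fin (m + 1)) = Fin.castSucc i := rfl
      rw [Function.comp_apply, Equiv.trans_apply, Equiv.symm_apply_apply, this, Fin.snoc_castSucc]
      rfl
    · have : (finSumFinEquiv (Sum.inr i) : Fin (m + 1)) = Fin.last m := by
        fin_cases i; rfl
      rw [Function.comp_apply, Equiv.trans_apply, Equiv.symm_apply_apply, this, Fin.snoc_last]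
      rfl
  have h2 := h.exch_reindex e
  rw [he, he] at h2
  obtain ⟨F, hF, hFx⟩ := h2 (m + 1) (Equiv.refl _)
  have : F = tau (Fin.snoc w a) (Fin.snoc w b) := by
    ext1 x
    rw [coe_tau]
    exact (hFx x).symm
  rwa [← this]

end Words

/-- Here `λ` is a partition of `A = {1,…,k}` (`k ≥ 3`) given by disjoint nonempty blocks
`B i` covering `A`, and `S` is the generating set consisting of (1) `τ_{a,b}` for all
`a ≠ b` in a common block, (2) `τ_{aa,ab}` for one chosen pair `a = ca i ≠ cb i = b` in
each block of size `> 1`, and (3) `1-SWAP_{a,b}` for one chosen pair `a = da i j ∈ B i`,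
`b = db i j ∈ B j` for each `i < j`.
Then `S` generates `τ_{wa,wb}` for every string `w` over `A` and all `a, b` in a
common block of `λ`. -/
theorem generates_tau_wa_wb (k l : ℕ) (hk : 3 ≤ k)
    (B : Fin l → Finset (Fin k))
    (hne : ∀ i, (B i).Nonempty)
    (hdisj : ∀ i j, i ≠ j → Disjoint (B i) (B j))
    (hcover : ∀ x : Fin k, ∃ i, x ∈ B i)
    (ca cb : Fin l → Fin k)
    (hc : ∀ i, 1 < (B i).card → ca i ∈ B i ∧ cb i ∈ B i ∧ ca i ≠ cb i)
    (da db : Fin l → Fin l → Fin k)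
    (hd : ∀ i j, i < j → da i j ∈ B i ∧ db i j ∈ B j)
    (l' : ℕ) (w : Fin l' → Fin k) (a b : Fin k) (i : Fin l)
    (ha : a ∈ B i) (hb : b ∈ B i) :
    Generates ({g : Gate (Fin k) | ∃ (i : Fin l) (a b : Fin k),
        a ∈ B i ∧ b ∈ B i ∧ a ≠ b ∧ g = ⟨1, tau ![a] ![b]⟩} ∪
      {g : Gate (Fin k) | ∃ i : Fin l, 1 < (B i).card ∧
        g = ⟨2, tau ![ca i, ca i] ![ca i, cb i]⟩} ∪
      {g : Gate (Fin k) | ∃ i j : Fin l, i < j ∧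
        g = ⟨1 + 2, controlled ![(⟨0, by omega⟩ : Fin k)]
          (swapGate (da i j) (db i j))⟩})
      ⟨l' + 1, tau (Fin.snoc w a) (Fin.snoc w b)⟩ := by
  classical
  set S : Set (Gate (Fin k)) := _
  change Generates S _
  by_cases hab : a = b
  · subst hab
    have : tau (Fin.snoc w a : Fin (l' + 1) → Fin k) (Fin.snoc w a) = Equiv.refl _ :=
      Equiv.swap_self _
    rw [this]
    exact generates_refl _ _
  have hletter : ∀ (i : Fin l), ∀ a ∈ B i, ∀ b ∈ B i, Realizes S (letterSwap a b) := by
    intro i a ha b hb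
    by_cases hab : a = b
    · subst hab
      exact Realizes.refl.congr_fun fun x => exch_self _ _
    · have h : Generates S ⟨1, tau ![a] ![b]⟩ :=
        Generates.mem (Or.inl (Or.inl ⟨i, a, b, ha, hb, hab, rfl⟩))
      have h2 := Realizes.of_generates h
      simp only [coe_tau] at h2
      convert h2.exch_reindex (Equiv.ofUnique Unit (Fin 1)) using 2 <;>
      · funext i; rfl
  have hblock : ∀ {i j : Fin l} {x y : Fin k}, i ≠ j → x ∈ B i → y ∈ B j → x ≠ y := by
    rintro i j x y hij hx hy rfl
    exact Finset.disjoint_left.1 (hdisj i j hij) hx hy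
  have hswap : ∀ p ∈ (B i : Set (Fin k)), ∀ c, c ∉ (B i : Set (Fin k)) →
      Realizes S (ctlGate {fun _ : Unit => (⟨0, by omega⟩ : Fin k)} (pairSwap p c)) := by
    intro p hp c hc
    obtain ⟨j, hj⟩ := hcover c
    have key : ∀ i j : Fin l, i < j → ∀ p ∈ B i, ∀ c ∈ B j,
        Realizes S (ctlGate {fun _ : Unit => (⟨0, by omega⟩ : Fin k)} (pairSwap p c)) := by
      intro i j hij p hp c hc
      have hbase : Realizes S (ctlGate {fun _ : Unit => (⟨0, by omega⟩ : Fin k)}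
          (pairSwap (da i j) (db i j))) :=
        realizes_ctlGate_pairSwap (Generates.mem (Or.inr ⟨i, j, hij, rfl⟩))
      have h1 := (hd i j hij).1
      have h2 := (hd i j hij).2
      have hA := hbase.pairSwap_left (hletter i _ h1 _ hp) (hblock hij.ne h1 h2).symm
        (hblock hij.ne hp h2).symm
      rw [pairSwap_comm] at hA ⊢
      exact hA.pairSwap_left (hletter j _ h2 _ hc) (hblock hij.ne hp h2) (hblock hij.ne hp hc)
    have hij : i ≠ j := by
      rintro rfl
      exact hc hj
    rcases lt_or_gt_of_ne hij with h | h
    · exact key i j h p hp c hj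
    · rw [pairSwap_comm]
      exact key j i h c hj p hp
  have hP := hletter i
  have hcard : 1 < (B i).card := Finset.one_lt_card.2 ⟨a, ha, b, hb, hab⟩
  have hmem : ∀ c ∈ (B i : Set (Fin k)), Ctrl S (B i : Set (Fin k)) {fun _ : Unit => c} := by
    obtain ⟨h1, h2, h3⟩ := hc i hcard
    have h : Generates S ⟨2, tau ![ca i, ca i] ![ca i, cb i]⟩ :=
      Generates.mem (Or.inl (Or.inr ⟨i, hcard, rfl⟩))
    have h' := Realizes.of_generates h
    simp only [coe_tau] at h'
    exact Ctrl.singleton_of_mem hP h1 h2 h3 h'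
  have hsingle : ∀ c, Ctrl S (B i : Set (Fin k)) {fun _ : Unit => c} := by
    intro c
    by_cases hcB : c ∈ B i
    · exact hmem c hcB
    · exact Ctrl.singleton_of_notMem hP (fun h => hcB (h ▸ ha)) (hmem a ha)
        (hswap a ha c hcB).exch_of_ctl
  have hinter : ∀ D₁ D₂ : Set (Fin l' → Fin k), Ctrl S (B i : Set (Fin k)) D₁ →
      Ctrl S (B i : Set (Fin k)) D₂ → Ctrl S (B i : Set (Fin k)) (D₁ ∩ D₂) := by
    intro D₁ D₂ h₁ h₂
    by_cases hB : ∃ c, c ∉ B i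
    · obtain ⟨c, hcB⟩ := hB
      exact h₁.inter_of_pairSwap h₂ hmem hswap ha hb hab hcB
    · push Not at hB
      have h3 : 2 < (B i).card := by
        rw [Finset.eq_univ_of_forall hB, Finset.card_univ, Fintype.card_fin]
        omega
      obtain ⟨p, hp, q, hq, r, hr, hpq, hpr, hqr⟩ := Finset.two_lt_card.1 h3
      exact h₁.inter_of_three h₂ hmem hp hq hr hpq hpr hqr
  exact generates_tau_snoc (Ctrl.singleton hP hsingle hinter w a ha b hb)
end

section
/- Let A be a finite alphabet with |A| ≥ 2 and let S be a finite set of reversible gates over A such that each gate in S has a fixed point. Then ⟨S⟩ is generated by a single gate; in fact, if S = {F_1,…,F_n}, then ⟨S⟩ = ⟨F_1 ⊗ ⋯ ⊗ F_n⟩. -/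
/-- The tensor product `F₁ ⊗ ⋯ ⊗ Fₙ` of a list of gates. -/
def bigTensor {A : Type*} : List (Gate A) → Gate A
  | [] => ⟨0, Equiv.refl _⟩
  | g :: gs => ⟨g.1 + (bigTensor gs).1, tensorGate g.2 (bigTensor gs).2⟩

section

variable {A : Type*}

theorem Generates.trans {S T : Set (Gate A)} (hST : ∀ g ∈ S, Generates T g) {g : Gate A}
    (hg : Generates S g) : Generates T g := by
  induction hg with
  | mem h => exact hST _ h
  | perm n σ => exact .perm n σ
  | tensor _ _ hF hG => exact .tensor hF hG
  | comp _ _ hF hG => exact .comp hF hG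
  | ancilla a _ h hF => exact .ancilla a hF h

theorem genClosure_eq_of_generates {S T : Set (Gate A)} (hST : ∀ g ∈ S, Generates T g)
    (hTS : ∀ g ∈ T, Generates S g) : genClosure S = genClosure T :=
  Set.Subset.antisymm (fun _ => Generates.trans hST) (fun _ => Generates.trans hTS)

/-- Gate classes are closed under relabelling the wires. -/
theorem Generates.relabel {S : Set (Gate A)} {n m : ℕ} (e : Fin n ≃ Fin m) {F : GateFun A n}
    (hF : Generates S ⟨n, F⟩) :
    Generates S ⟨m, (Equiv.arrowCongr e (Equiv.refl A)).permCongr F⟩ := by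
  obtain rfl : n = m := Fin.equiv_iff_eq.mp ⟨e⟩
  exact .comp (.perm n e.symm) (.comp hF (.perm n e))

theorem tensorGate_splitEquiv_symm {n m : ℕ} (F : GateFun A n) (G : GateFun A m)
    (x : Fin n → A) (y : Fin m → A) :
    tensorGate F G ((splitEquiv A n m).symm (x, y)) = (splitEquiv A n m).symm (F x, G y) := by
  simp [tensorGate]

/-- The bijection of wires that exchanges the first `n` wires with the last `m` wires. -/
def blockSwap (n m : ℕ) : Fin (n + m) ≃ Fin (m + n) :=
  (finSumFinEquiv.symm.trans (Equiv.sumComm _ _)).trans finSumFinEquiv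

theorem arrowCongr_blockSwap_splitEquiv_symm {n m : ℕ} (x : Fin n → A) (y : Fin m → A) :
    Equiv.arrowCongr (blockSwap n m) (Equiv.refl A) ((splitEquiv A n m).symm (x, y)) =
      (splitEquiv A m n).symm (y, x) := by
  funext i
  obtain ⟨j, rfl⟩ := finSumFinEquiv.surjective i
  cases j <;> simp [blockSwap, splitEquiv, Equiv.arrowCongr, Equiv.sumArrowEquivProdArrow]

theorem Generates.right_of_tensor {S : Set (Gate A)} {n m : ℕ} {F : GateFun A n}
    {G : GateFun A m} (h : Generates S ⟨n + m, tensorGate F G⟩) {x : Fin n → A}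
    (hx : F x = x) : Generates S ⟨m, G⟩ :=
  .ancilla x h fun b => by rw [tensorGate_splitEquiv_symm, hx]

theorem permCongr_blockSwap_tensorGate {n m : ℕ} (F : GateFun A n) (G : GateFun A m) :
    (Equiv.arrowCongr (blockSwap n m) (Equiv.refl A)).permCongr (tensorGate F G) =
      tensorGate G F := by
  ext1 z
  obtain ⟨⟨y, x⟩, rfl⟩ := (splitEquiv A m n).symm.surjective z
  rw [Equiv.permCongr_apply, ← arrowCongr_blockSwap_splitEquiv_symm, Equiv.symm_apply_apply,
    tensorGate_splitEquiv_symm, arrowCongr_blockSwap_splitEquiv_symm,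
    arrowCongr_blockSwap_splitEquiv_symm, tensorGate_splitEquiv_symm]

theorem Generates.left_of_tensor {S : Set (Gate A)} {n m : ℕ} {F : GateFun A n}
    {G : GateFun A m} (h : Generates S ⟨n + m, tensorGate F G⟩) {y : Fin m → A}
    (hy : G y = y) : Generates S ⟨n, F⟩ := by
  have h' := h.relabel (blockSwap n m)
  rw [permCongr_blockSwap_tensorGate] at h'
  exact h'.right_of_tensor hy

theorem exists_fixed_bigTensor (L : List (Gate A)) (hfix : ∀ g ∈ L, ∃ x, g.2 x = x) :
    ∃ x, (bigTensor L).2 x = x := by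
  induction L with
  | nil => exact ⟨Fin.elim0, rfl⟩
  | cons g L ih =>
    obtain ⟨x, hx⟩ := hfix g List.mem_cons_self
    obtain ⟨y, hy⟩ := ih fun f hf => hfix f (List.mem_cons_of_mem _ hf)
    refine ⟨(splitEquiv A _ _).symm (x, y), ?_⟩
    exact (tensorGate_splitEquiv_symm _ _ _ _).trans (by rw [hx, hy])

theorem generates_bigTensor {S : Set (Gate A)} (L : List (Gate A))
    (hL : ∀ g ∈ L, Generates S g) : Generates S (bigTensor L) := by
  induction L with
  | nil => exact .perm 0 (Equiv.refl _)
  | cons g L ih =>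
    exact .tensor (hL g List.mem_cons_self) (ih fun f hf => hL f (List.mem_cons_of_mem _ hf))

theorem Generates.of_bigTensor {S : Set (Gate A)} {L : List (Gate A)}
    (hfix : ∀ g ∈ L, ∃ x, g.2 x = x) (hS : Generates S (bigTensor L)) :
    ∀ g ∈ L, Generates S g := by
  induction L with
  | nil => simp
  | cons f L ih =>
    have hfix' : ∀ g ∈ L, ∃ x, g.2 x = x := fun g hg => hfix g (List.mem_cons_of_mem _ hg)
    obtain ⟨x, hx⟩ := hfix f List.mem_cons_self
    obtain ⟨y, hy⟩ := exists_fixed_bigTensor L hfix'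
    intro g hg
    rcases List.mem_cons.mp hg with rfl | hg
    · exact Generates.left_of_tensor hS hy
    · exact ih hfix' (Generates.right_of_tensor hS hx) g hg

end

/-- If `S = {F₁,…,Fₙ}` is a finite set of reversible gates each of which has a fixed
point, then `⟨S⟩` is generated by a single gate; in fact `⟨S⟩ = ⟨F₁ ⊗ ⋯ ⊗ Fₙ⟩`. -/
theorem single_gate_generation (A : Type*) [Fintype A] [DecidableEq A]
    (hA : 2 ≤ Fintype.card A)
    (L : List (Gate A)) (hfix : ∀ g ∈ L, ∃ x, g.2 x = x) :
    (∃ g₀ : Gate A, genClosure {g : Gate A | g ∈ L} = genClosure {g₀}) ∧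
      genClosure {g : Gate A | g ∈ L} = genClosure {bigTensor L} := by
  have h : genClosure {g : Gate A | g ∈ L} = genClosure {bigTensor L} := by
    refine genClosure_eq_of_generates (Generates.of_bigTensor hfix (.mem rfl)) ?_
    rintro _ rfl
    exact generates_bigTensor L fun g hg => .mem hg
  exact ⟨⟨bigTensor L, h⟩, h⟩
end

section
/- Let A = {1,…,k} with k ≥ 3 and let m ≥ 1. If a reversible gate F : A^n → A^n is mod-m-respecting, then it is mod-m-preserving. That is, if there exists 0 ≤ j ≤ m−1 such that for every w ∈ A^n, c_k(F(w)) ≡ c_k(w) + j (mod m), then j = 0. -/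
/-- `c_k(x)`: the number of occurrences of the symbol `k` (the top element `⟨k-1,_⟩`
of `Fin k`) in the string `x`. -/
def countLast {k n : ℕ} (x : Fin n → Fin k) : ℕ :=
  (Finset.univ.filter fun i => (x i : ℕ) = k - 1).card

/-- The generating function of `countLast` over `A^n`, where `A` has `k` symbols. -/
theorem sum_pow_countLast {R : Type*} [CommRing R] {k : ℕ} (hk : 1 ≤ k) (n : ℕ) (z : R) :
    ∑ w : Fin n → Fin k, z ^ countLast w = (z + (k - 1)) ^ n := by
  obtain ⟨l, rfl⟩ := Nat.exists_eq_add_of_le' hk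
  have hsum : ∑ a : Fin (l + 1), (if (a : ℕ) = l + 1 - 1 then z else 1) =
      z + (((l + 1 : ℕ) : R) - 1) := by
    rw [Fin.sum_univ_castSucc, Finset.sum_congr rfl fun a _ => if_neg (by simp [a.2.ne])]
    simp [add_comm]
  rw [← hsum, Fintype.sum_pow]
  refine Finset.sum_congr rfl fun w _ => ?_
  rw [Finset.prod_ite]
  simp [countLast]

/-- Over `A = {1,…,k}` with `k ≥ 3`: a mod-`m`-respecting reversible gate is
mod-`m`-preserving. That is, if `c_k(F(w)) ≡ c_k(w) + j (mod m)` for all `w ∈ Aⁿ`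
with a fixed `0 ≤ j < m`, then `j = 0`. -/
theorem mod_respecting_is_mod_preserving (k n m j : ℕ) (hk : 3 ≤ k)
    (hm : 1 ≤ m) (hj : j < m) (F : GateFun (Fin k) n)
    (h : ∀ w : Fin n → Fin k, countLast (F w) ≡ countLast w + j [MOD m]) :
    j = 0 := by
  have hζ := Complex.isPrimitiveRoot_exp m (by omega)
  set ζ := Complex.exp (2 * Real.pi * Complex.I / m)
  have hpow (w : Fin n → Fin k) : ζ ^ countLast (F w) = ζ ^ countLast w * ζ ^ j := by
    rw [← pow_add, pow_eq_pow_mod _ hζ.pow_eq_one, h w, ← pow_eq_pow_mod _ hζ.pow_eq_one]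
  have hsum : ∑ w : Fin n → Fin k, ζ ^ countLast w =
      (∑ w : Fin n → Fin k, ζ ^ countLast w) * ζ ^ j := by
    rw [Finset.sum_mul, ← Equiv.sum_comp F]
    exact Finset.sum_congr rfl fun w _ => hpow w
  have hne : ζ + ((k : ℂ) - 1) ≠ 0 := by
    intro h0
    have hnorm : ‖ζ‖ = 1 := hζ.norm'_eq_one (by omega)
    have hk' : (3 : ℝ) ≤ k := by exact_mod_cast hk
    rw [eq_neg_of_add_eq_zero_left h0, norm_neg,
      show (k : ℂ) - 1 = ((k - 1 : ℝ) : ℂ) by push_cast; rfl, Complex.norm_real,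
      Real.norm_of_nonneg (by linarith)] at hnorm
    linarith
  rw [sum_pow_countLast (by omega)] at hsum
  have hj1 : ζ ^ j = 1 := (left_eq_mul₀ (pow_ne_zero n hne)).1 hsum
  exact Nat.eq_zero_of_dvd_of_lt (hζ.dvd_of_pow_eq_one j hj1) hj
end

section
/- Let A = {1,…,k} with k ≥ 3 and let F : A^n → A^n be a reversible gate with m = m(F) ≥ 1. Then there exist t ≥ 1 and a string w ∈ A^{nt} such that c_k(F^{⊗t}(w)) − c_k(w) = m, where F^{⊗t} denotes the t-fold tensor product of F with itself. -/
/-- A gate is mod-`m`-preserving if it preserves the number of `k` symbols mod `m`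
(for `m = 0` this means preserving it exactly). -/
def ModPreserving {k : ℕ} (m : ℕ) (g : Gate (Fin k)) : Prop :=
  ∀ w, countLast (g.2 w) ≡ countLast w [MOD m]

/-- `IsModIndex g M` states that `M = m(g)`: the gate `g` is mod-`M`-preserving and
every `m` for which `g` is mod-`m`-preserving divides `M`. (Equivalently, `M` is the
largest modulus preserved by `g`, with `M = 0` when no largest one exists.) -/
def IsModIndex {k : ℕ} (g : Gate (Fin k)) (M : ℕ) : Prop :=
  ModPreserving M g ∧ ∀ m, ModPreserving m g → m ∣ M

/-- The `t`-fold tensor power `F^{⊗t}` of a gate. -/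
def tensorPow {A : Type*} {n : ℕ} (F : GateFun A n) : (t : ℕ) → GateFun A (n * t)
  | 0 => Equiv.refl _
  | t + 1 => tensorGate (tensorPow F t) F

/-- Counting the top symbol is additive under concatenation of strings. -/
theorem countLast_splitEquiv_symm {k n m : ℕ} (a : Fin n → Fin k) (b : Fin m → Fin k) :
    countLast ((splitEquiv (Fin k) n m).symm (a, b)) = countLast a + countLast b := by
  simp only [countLast, Finset.card_filter, Fin.sum_univ_add]
  congr 1 <;> refine Finset.sum_congr rfl fun i _ => ?_ <;>
    simp [splitEquiv, Equiv.arrowCongr, Equiv.sumArrowEquivProdArrow]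

/-- The change in the number of top symbols caused by applying `F` to `w`. -/
def countShift {k n : ℕ} (F : GateFun (Fin k) n) (w : Fin n → Fin k) : ℤ :=
  countLast (F w) - countLast w

theorem sum_countShift {k n : ℕ} (F : GateFun (Fin k) n) : ∑ w, countShift F w = 0 := by
  simp only [countShift, Finset.sum_sub_distrib]
  rw [Equiv.sum_comp F fun w => (countLast w : ℤ), sub_self]

theorem countShift_tensorGate {k n m : ℕ} (F : GateFun (Fin k) n) (G : GateFun (Fin k) m)
    (a : Fin n → Fin k) (b : Fin m → Fin k) :
    countShift (tensorGate F G) ((splitEquiv (Fin k) n m).symm (a, b)) =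
      countShift F a + countShift G b := by
  simp only [countShift, tensorGate, Equiv.trans_apply, Equiv.apply_symm_apply,
    Equiv.prodCongr_apply, Prod.map_apply, countLast_splitEquiv_symm]
  push_cast
  ring

theorem exists_countShift_tensorPow {k n : ℕ} (F : GateFun (Fin k) n) {z : ℤ}
    (hz : z ∈ AddSubmonoid.closure (Set.range (countShift F))) :
    ∃ t : ℕ, ∃ w, countShift (tensorPow F t) w = z := by
  induction hz using AddSubmonoid.closure_induction_right with
  | zero =>
    exact ⟨0, finZeroElim, by simp [countShift, tensorPow]⟩
  | add_right x _ y hy ih =>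
    obtain ⟨t, w, rfl⟩ := ih
    obtain ⟨v, rfl⟩ := hy
    exact ⟨t + 1, (splitEquiv (Fin k) (n * t) n).symm (w, v), countShift_tensorGate _ _ _ _⟩

/-- The sums of shifts form a group, since the shifts of a gate add up to zero. -/
def shiftSubgroup {k n : ℕ} (F : GateFun (Fin k) n) : AddSubgroup ℤ where
  __ := AddSubmonoid.closure (Set.range (countShift F))
  neg_mem' {x} hx := by
    change x ∈ AddSubmonoid.closure (Set.range (countShift F)) at hx
    change -x ∈ AddSubmonoid.closure (Set.range (countShift F))
    induction hx using AddSubmonoid.closure_induction with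
    | zero => simp
    | add x y _ _ hx hy =>
      rw [neg_add]
      exact add_mem hx hy
    | mem x hx =>
      obtain ⟨w, rfl⟩ := hx
      have h := Finset.add_sum_erase Finset.univ (countShift F) (Finset.mem_univ w)
      rw [sum_countShift] at h
      rw [neg_eq_of_add_eq_zero_right h]
      exact sum_mem fun v _ => AddSubmonoid.subset_closure ⟨v, rfl⟩

theorem mem_shiftSubgroup_of_isModIndex {k n m : ℕ} {F : GateFun (Fin k) n}
    (hF : IsModIndex (⟨n, F⟩ : Gate (Fin k)) m) : (m : ℤ) ∈ shiftSubgroup F := by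
  obtain ⟨g, hg⟩ := Int.subgroup_cyclic (shiftSubgroup F)
  rw [← AddSubgroup.zmultiples_eq_closure] at hg
  rw [hg, Int.mem_zmultiples_iff, ← Int.natAbs_dvd, Int.natCast_dvd_natCast]
  refine hF.2 _ fun w => ?_
  have hw : countShift F w ∈ shiftSubgroup F := AddSubmonoid.subset_closure ⟨w, rfl⟩
  rw [hg, Int.mem_zmultiples_iff, ← Int.natAbs_dvd] at hw
  exact (Nat.modEq_iff_dvd.2 hw).symm

/-- Over `A = {1,…,k}` with `k ≥ 3`: for any reversible gate `F : Aⁿ → Aⁿ` with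
`m = m(F) ≥ 1`, there are `t ≥ 1` and a string `w ∈ A^{nt}` such that
`c_k(F^{⊗t}(w)) - c_k(w) = m`. -/
theorem exists_tensor_power_shift (k : ℕ) (hk : 3 ≤ k) {n : ℕ}
    (F : GateFun (Fin k) n) (m : ℕ) (hm : 1 ≤ m)
    (hF : IsModIndex (⟨n, F⟩ : Gate (Fin k)) m) :
    ∃ t : ℕ, 1 ≤ t ∧ ∃ w : Fin (n * t) → Fin k,
      countLast (tensorPow F t w) = countLast w + m := by
  obtain ⟨t, w, hw⟩ := exists_countShift_tensorPow F (mem_shiftSubgroup_of_isModIndex hF)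
  refine ⟨t, Nat.one_le_iff_ne_zero.2 ?_, w, ?_⟩
  · rintro rfl
    simp only [countShift, tensorPow, Equiv.refl_apply, sub_self] at hw
    omega
  · rw [countShift] at hw
    omega
end
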